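/- Let k > 0, let f : (0,∞) → ℝ be k-convex on (0,∞) with f(1) = 0, let 0 ≤ ε ≤ 1, and let P and Q be probability distributions on Fin n → Bool with P(x) > 0 and Q(x) > 0 for all x. If D_f(P‖Q) < k·ε², then for every subset S ⊆ Fin n and every assignment e : Fin n → Bool, |max_{x ∈ C} P(x) − max_{x ∈ C} Q(x)| < ε, where C = {x : x(i) = e(i) for all i ∈ S} (a nonempty finite set, so both maxima exist). (Theorem B.3: bounded k-convex f-divergence implies absolute approximation of maximum-a-posteriori values.) -/

import Mathlib

/-- A `k`-convex function becomes convex after subtracting `k / 2 * x ^ 2`. -/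
lemma convexOn_sub_sq_of_kconvex {k : ℝ} {f : ℝ → ℝ}
    (hkconv : ∀ x ∈ Set.Ioi (0 : ℝ), ∀ y ∈ Set.Ioi (0 : ℝ),
      ∀ t ∈ Set.Icc (0 : ℝ) 1,
        f ((1 - t) * x + t * y) ≤
          (1 - t) * f x + t * f y - k * t * (1 - t) * (x - y) ^ 2 / 2) :
    ConvexOn ℝ (Set.Ioi (0 : ℝ)) (fun x ↦ f x - k / 2 * x ^ 2) := by
  refine ⟨convex_Ioi 0, fun x hx y hy a b ha hb hab ↦ ?_⟩
  obtain rfl : a = 1 - b := by linarith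
  have h := hkconv x hx y hy b ⟨hb, by linarith⟩
  simp only [smul_eq_mul]
  linear_combination h

/-- The `f`-divergence of a `k`-convex `f` dominates `k / 2` times the `χ²`-divergence. -/
lemma half_mul_chiSq_le_fdiv {Ω : Type*} [Fintype Ω] {k : ℝ} {f : ℝ → ℝ}
    (hkconv : ∀ x ∈ Set.Ioi (0 : ℝ), ∀ y ∈ Set.Ioi (0 : ℝ),
      ∀ t ∈ Set.Icc (0 : ℝ) 1,
        f ((1 - t) * x + t * y) ≤
          (1 - t) * f x + t * f y - k * t * (1 - t) * (x - y) ^ 2 / 2)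
    (hf1 : f 1 = 0) {P Q : Ω → ℝ}
    (hP0 : ∀ x, 0 < P x) (hP1 : ∑ x, P x = 1)
    (hQ0 : ∀ x, 0 < Q x) (hQ1 : ∑ x, Q x = 1) :
    k / 2 * ∑ x, (P x - Q x) ^ 2 / Q x ≤ ∑ x, Q x * f (P x / Q x) := by
  have hJ := (convexOn_sub_sq_of_kconvex hkconv).map_sum_le (t := Finset.univ) (w := Q)
    (p := fun x ↦ P x / Q x) (fun x _ ↦ (hQ0 x).le) hQ1 (fun x _ ↦ div_pos (hP0 x) (hQ0 x))
  have hmean : ∑ x, Q x • (P x / Q x) = 1 := by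
    rw [← hP1]
    exact Finset.sum_congr rfl fun x _ ↦ mul_div_cancel₀ (P x) (hQ0 x).ne'
  have hterm : ∀ x, Q x • (f (P x / Q x) - k / 2 * (P x / Q x) ^ 2) =
      Q x * f (P x / Q x) - k / 2 * ((P x - Q x) ^ 2 / Q x) - k * P x + k / 2 * Q x := by
    intro x
    have := (hQ0 x).ne'
    simp only [smul_eq_mul]
    field_simp
    ring
  simp only [hmean, hterm, hf1, Finset.sum_add_distrib, Finset.sum_sub_distrib,
    ← Finset.mul_sum, hP1, hQ1] at hJ
  linarith

/-- A pointwise difference of two functions of equal total mass is at most half their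
`ℓ¹`-distance, that is, their total variation distance. -/
lemma two_mul_abs_sub_le_sum_abs_sub {Ω : Type*} [Fintype Ω] {P Q : Ω → ℝ}
    (h : ∑ x, P x = ∑ x, Q x) (a : Ω) :
    2 * |P a - Q a| ≤ ∑ x, |P x - Q x| := by
  classical
  have hsum : ∑ x, (P x - Q x) = 0 := by rw [Finset.sum_sub_distrib, h, sub_self]
  rw [← Finset.add_sum_erase _ _ (Finset.mem_univ a)] at hsum ⊢
  have habs := Finset.abs_sum_le_sum_abs (fun x ↦ P x - Q x) (Finset.univ.erase a)
  rw [← neg_eq_of_add_eq_zero_right hsum, abs_neg] at habs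
  linarith

/-- The square of the `ℓ¹`-distance is at most the `χ²`-divergence. -/
lemma sq_sum_abs_sub_le_chiSq {Ω : Type*} [Fintype Ω] {P Q : Ω → ℝ}
    (hQ0 : ∀ x, 0 < Q x) (hQ1 : ∑ x, Q x = 1) :
    (∑ x, |P x - Q x|) ^ 2 ≤ ∑ x, (P x - Q x) ^ 2 / Q x := by
  simpa [hQ1] using
    Finset.sq_sum_div_le_sum_sq_div Finset.univ (fun x ↦ |P x - Q x|) (fun x _ ↦ hQ0 x)

/-- Uniformly close functions have close maxima. -/
lemma abs_sup'_sub_sup'_lt {Ω : Type*} {s : Finset Ω} (hs : s.Nonempty) {P Q : Ω → ℝ} {ε : ℝ}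
    (h : ∀ x ∈ s, |P x - Q x| < ε) : |s.sup' hs P - s.sup' hs Q| < ε := by
  obtain ⟨a, ha, hPa⟩ := s.exists_mem_eq_sup' hs P
  obtain ⟨b, hb, hQb⟩ := s.exists_mem_eq_sup' hs Q
  have hPb := s.le_sup' P hb
  have hQa := s.le_sup' Q ha
  have h1 := abs_lt.1 (h a ha)
  have h2 := abs_lt.1 (h b hb)
  rw [abs_lt]
  constructor <;> linarith

/-- Theorem B.3: bounded `k`-convex `f`-divergence implies absolute
approximation of maximum-a-posteriori values for every evidence. -/
theorem bounded_fdiv_implies_absolute_map {n : ℕ}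
    (k : ℝ) (hk : 0 < k) (f : ℝ → ℝ)
    (hkconv : ∀ x ∈ Set.Ioi (0 : ℝ), ∀ y ∈ Set.Ioi (0 : ℝ),
      ∀ t ∈ Set.Icc (0 : ℝ) 1,
        f ((1 - t) * x + t * y) ≤
          (1 - t) * f x + t * f y - k * t * (1 - t) * (x - y) ^ 2 / 2)
    (hf1 : f 1 = 0)
    (ε : ℝ) (hε0 : 0 ≤ ε) (hε1 : ε ≤ 1)
    (P Q : (Fin n → Bool) → ℝ)
    (hP0 : ∀ x, 0 < P x) (hP1 : ∑ x, P x = 1)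
    (hQ0 : ∀ x, 0 < Q x) (hQ1 : ∑ x, Q x = 1)
    (hdiv : ∑ x, Q x * f (P x / Q x) < k * ε ^ 2) :
    ∀ (S : Finset (Fin n)) (e : Fin n → Bool)
      (hC : (Finset.univ.filter
        (fun x : Fin n → Bool => ∀ i ∈ S, x i = e i)).Nonempty),
      |(Finset.univ.filter
          (fun x : Fin n → Bool => ∀ i ∈ S, x i = e i)).sup' hC P
        - (Finset.univ.filter
          (fun x : Fin n → Bool => ∀ i ∈ S, x i = e i)).sup' hC Q| < ε := by
  intro S e hC
  refine abs_sup'_sub_sup'_lt hC fun x _ ↦ abs_lt_of_sq_lt_sq ?_ hε0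
  have hdiv_ge := half_mul_chiSq_le_fdiv hkconv hf1 hP0 hP1 hQ0 hQ1
  have hchi := sq_sum_abs_sub_le_chiSq (P := P) hQ0 hQ1
  have htv := pow_le_pow_left₀ (by positivity)
    (two_mul_abs_sub_le_sum_abs_sub (hP1.trans hQ1.symm) x) 2
  rw [mul_pow, sq_abs] at htv
  have hlt : k * (∑ x, (P x - Q x) ^ 2 / Q x) < k * (2 * ε ^ 2) := by linarith
  have := lt_of_mul_lt_mul_left hlt hk.le
  nlinarith [sq_nonneg (P x - Q x)]
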